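/- Uniform closeness of traces (Eq. (traceBC)): with the toymodel matrices on a finite cube Λ ⊂ ℤ^d containing nearest-neighbour sites i₁, i₂ — namely B = (λ − i(E+Δ))|_{Λ∖{i₁,i₂}}, C_{++} = λ(1 − δ²𝟙_{12}) − i(E+Δ) on ℂ^Λ, and S_{++} the 2×2 Schur complement S_{++} = −i(E+Δ)|_{{i₁,i₂}} + λ(1−δ²)·1₂ + D B^{−1} Dᵀ — one has the exact identity Tr C_{++}^{−1} = Tr B^{−1} + Tr( S_{++}^{−1} (1₂ − D B^{−2} Dᵀ) ), and there exists a constant K > 0, depending only on d, E and λ (but not on Λ), such that |Tr C_{++}^{−1} − Tr B^{−1}| ≤ K for every finite cube Λ and every 0 < δ ≤ 1/2. Consequently Tr B^{−1}/Tr C_{++}^{−1} = 1 + O(|Λ|^{−1}). -/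

import Mathlib

open Matrix

noncomputable section

/-- ℓ¹ distance on ℤ^d. -/
def dist1 {d : ℕ} (x y : Fin d → ℤ) : ℤ := ∑ i, |x i - y i|

/-- The cube [-L, L]^d in ℤ^d, centered at the origin. -/
def cube (d L : ℕ) : Finset (Fin d → ℤ) :=
  Finset.Icc (fun _ => -(L : ℤ)) (fun _ => (L : ℤ))

/-- Entries of the discrete Laplacian associated to a finite volume Λ. -/
def lapE {d : ℕ} (Λ : Finset (Fin d → ℤ)) (j k : Fin d → ℤ) : ℂ :=
  (if dist1 j k = 1 then 1 else 0) -
    (if j = k then ((Λ.filter (fun k' => dist1 j k' = 1)).card : ℂ) else 0)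

/-- The toymodel matrix `C_{++} = λ(1 - δ²𝟙_{12}) - i(E+Δ)` on `ℂ^Λ`. -/
def Cpp {d : ℕ} (Λ : Finset (Fin d → ℤ)) (i₁ i₂ : Fin d → ℤ) (E lam δ : ℝ) :
    Matrix Λ Λ ℂ := fun j k =>
  (lam : ℂ) * ((if j = k then 1 else 0) -
      (δ : ℂ) ^ 2 * (if j = k ∧ ((j : Fin d → ℤ) = i₁ ∨ (j : Fin d → ℤ) = i₂) then 1 else 0)) -
    Complex.I * ((if j = k then (E : ℂ) else 0) + lapE Λ (j : Fin d → ℤ) (k : Fin d → ℤ))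

/-- The matrix `B = (λ - i(E+Δ))|_{Λ∖{i₁,i₂}}`. -/
def Bmat {d : ℕ} (Λ : Finset (Fin d → ℤ)) (i₁ i₂ : Fin d → ℤ) (E lam : ℝ) :
    Matrix ((Λ.erase i₁).erase i₂) ((Λ.erase i₁).erase i₂) ℂ := fun j k =>
  (lam : ℂ) * (if j = k then 1 else 0) -
    Complex.I * ((if j = k then (E : ℂ) else 0) + lapE Λ (j : Fin d → ℤ) (k : Fin d → ℤ))

/-- The 2 × |Λ∖{i₁,i₂}| coupling matrix `D` of neighbours of `i₁, i₂`. -/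
def Dmat {d : ℕ} (Λ : Finset (Fin d → ℤ)) (i₁ i₂ : Fin d → ℤ) :
    Matrix (Fin 2) ((Λ.erase i₁).erase i₂) ℂ := fun a k =>
  if dist1 (![i₁, i₂] a) (k : Fin d → ℤ) = 1 then 1 else 0

/-- The block `A₀ = -i(E+Δ)|_{{i₁,i₂}}`. -/
def A0mat {d : ℕ} (Λ : Finset (Fin d → ℤ)) (i₁ i₂ : Fin d → ℤ) (E : ℝ) :
    Matrix (Fin 2) (Fin 2) ℂ := fun a b =>
  -Complex.I * ((if a = b then (E : ℂ) else 0) + lapE Λ (![i₁, i₂] a) (![i₁, i₂] b))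

/-- The Schur complement `S_{++} = -i(E+Δ)|_{{i₁,i₂}} + λ(1-δ²)·1₂ + D B⁻¹ Dᵀ`. -/
def Spp {d : ℕ} (Λ : Finset (Fin d → ℤ)) (i₁ i₂ : Fin d → ℤ) (E lam δ : ℝ) :
    Matrix (Fin 2) (Fin 2) ℂ :=
  A0mat Λ i₁ i₂ E + ((lam : ℂ) * (1 - (δ : ℂ) ^ 2)) • (1 : Matrix (Fin 2) (Fin 2) ℂ) +
    Dmat Λ i₁ i₂ * (Bmat Λ i₁ i₂ E lam)⁻¹ * (Dmat Λ i₁ i₂)ᵀ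

section Coercive

variable {n : Type*} [Fintype n]

/-- `M` is coercive with constant `c`: its numerical range lies in `{z | c ≤ re z}`. -/
def IsCoerciveMatrix (M : Matrix n n ℂ) (c : ℝ) : Prop :=
  ∀ v : n → ℂ, c * ‖WithLp.toLp 2 v‖ ^ 2 ≤ (star v ⬝ᵥ M *ᵥ v).re

theorem norm_star_dotProduct_le (v w : n → ℂ) :
    ‖star v ⬝ᵥ w‖ ≤ ‖WithLp.toLp 2 v‖ * ‖WithLp.toLp 2 w‖ := by
  have h := norm_inner_le_norm (𝕜 := ℂ) (WithLp.toLp 2 v) (WithLp.toLp 2 w)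
  rwa [EuclideanSpace.inner_toLp_toLp, dotProduct_comm] at h

theorem IsCoerciveMatrix.mul_norm_le {M : Matrix n n ℂ} {c : ℝ} (hM : IsCoerciveMatrix M c)
    (v : n → ℂ) : c * ‖WithLp.toLp 2 v‖ ≤ ‖WithLp.toLp 2 (M *ᵥ v)‖ := by
  rcases (norm_nonneg (WithLp.toLp 2 v)).eq_or_lt with h0 | h0
  · rw [← h0]; simp
  · have h1 := (hM v).trans ((Complex.re_le_norm _).trans (norm_star_dotProduct_le v (M *ᵥ v)))
    nlinarith

variable [DecidableEq n]

theorem IsCoerciveMatrix.isUnit_det {M : Matrix n n ℂ} {c : ℝ} (hc : 0 < c)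
    (hM : IsCoerciveMatrix M c) : IsUnit M.det := by
  rw [← Matrix.isUnit_iff_isUnit_det, ← Matrix.mulVec_injective_iff_isUnit]
  intro v w hvw
  have h := hM.mul_norm_le (v - w)
  have h0 : M *ᵥ (v - w) = 0 := by rw [Matrix.mulVec_sub, sub_eq_zero]; exact hvw
  rw [h0, WithLp.toLp_zero, norm_zero] at h
  have h1 : ‖WithLp.toLp 2 (v - w)‖ = 0 :=
    le_antisymm (nonpos_of_mul_nonpos_right h hc) (norm_nonneg _)
  rw [norm_eq_zero, WithLp.toLp_eq_zero, sub_eq_zero] at h1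
  exact h1

theorem IsCoerciveMatrix.norm_inv_mulVec_le {M : Matrix n n ℂ} {c : ℝ} (hc : 0 < c)
    (hM : IsCoerciveMatrix M c) (w : n → ℂ) :
    ‖WithLp.toLp 2 (M⁻¹ *ᵥ w)‖ ≤ c⁻¹ * ‖WithLp.toLp 2 w‖ := by
  have h := hM.mul_norm_le (M⁻¹ *ᵥ w)
  rw [Matrix.mulVec_mulVec, Matrix.mul_nonsing_inv _ (hM.isUnit_det hc), Matrix.one_mulVec] at h
  rwa [inv_mul_eq_div, le_div_iff₀' hc]

theorem IsCoerciveMatrix.norm_inv_apply_le {M : Matrix n n ℂ} {c : ℝ} (hc : 0 < c)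
    (hM : IsCoerciveMatrix M c) (i j : n) : ‖M⁻¹ i j‖ ≤ c⁻¹ := by
  have h := hM.norm_inv_mulVec_le hc (Pi.single j 1)
  have h1 := PiLp.norm_apply_le (WithLp.toLp 2 (M⁻¹ *ᵥ Pi.single j 1)) i
  have h2 : ‖WithLp.toLp 2 (Pi.single j (1 : ℂ) : n → ℂ)‖ = 1 := by
    simp
  rw [h2, mul_one] at h
  have h3 := h1.trans h
  rwa [Matrix.mulVec_single_one] at h3

theorem IsCoerciveMatrix.le_re_inv_apply_self {M : Matrix n n ℂ} {c : ℝ} (hc : 0 < c)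
    (hM : IsCoerciveMatrix M c) {r : ℝ} (hr : 0 < r) (j : n)
    (hj : ‖WithLp.toLp 2 (star (M j))‖ ≤ r) : c / r ^ 2 ≤ (M⁻¹ j j).re := by
  set v := M⁻¹ *ᵥ Pi.single j 1 with hv
  have hMv : M *ᵥ v = Pi.single j 1 := by
    rw [hv, Matrix.mulVec_mulVec, Matrix.mul_nonsing_inv _ (hM.isUnit_det hc), Matrix.one_mulVec]
  have h1 : M j ⬝ᵥ v = 1 := by
    have := congrFun hMv j
    simpa [Matrix.mulVec] using this
  have h2 : 1 ≤ r * ‖WithLp.toLp 2 v‖ := by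
    have := norm_star_dotProduct_le (star (M j)) v
    rw [star_star, h1, norm_one] at this
    exact this.trans (mul_le_mul_of_nonneg_right hj (norm_nonneg _))
  have h3 := hM v
  rw [hMv] at h3
  have h4 : (star v ⬝ᵥ Pi.single j 1).re = (M⁻¹ j j).re := by
    simp [hv]
  rw [h4] at h3
  refine le_trans ?_ h3
  rw [div_eq_mul_inv]
  refine mul_le_mul_of_nonneg_left ?_ hc.le
  rw [inv_le_iff_one_le_mul₀ (by positivity), ← mul_pow, mul_comm]
  exact one_le_pow₀ h2

/-- A diagonal matrix bounded below, minus `i` times a Hermitian matrix, is coercive. -/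
theorem isCoerciveMatrix_diagonal_sub_I_smul {p : n → ℝ} {c : ℝ} (hp : ∀ j, c ≤ p j)
    {H : Matrix n n ℂ} (hH : H.IsHermitian) :
    IsCoerciveMatrix (Matrix.diagonal (fun j => (p j : ℂ)) - Complex.I • H) c := by
  intro v
  have h0 : (star v ⬝ᵥ H *ᵥ v).im = 0 := hH.im_star_dotProduct_mulVec_self v
  have h1 : (star v ⬝ᵥ Matrix.diagonal (fun j => (p j : ℂ)) *ᵥ v).re
      = ∑ j, p j * ‖v j‖ ^ 2 := by
    rw [dotProduct, Complex.re_sum]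
    refine Finset.sum_congr rfl fun j _ => ?_
    rw [Matrix.mulVec_diagonal, ← Complex.normSq_eq_norm_sq, Complex.normSq_apply]
    simp
    ring
  rw [Matrix.sub_mulVec, dotProduct_sub, Complex.sub_re, Matrix.smul_mulVec, dotProduct_smul,
    smul_eq_mul, Complex.I_mul_re, h0, h1, EuclideanSpace.norm_sq_eq, Finset.mul_sum]
  simp only [neg_zero, sub_zero]
  exact Finset.sum_le_sum fun j _ => mul_le_mul_of_nonneg_right (hp j) (sq_nonneg _)

end Coercive

section SchurComplement

variable {m n : Type*} [Fintype m] [DecidableEq m] [Fintype n] [DecidableEq n]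

theorem inv_fromBlocks_eq_of_isUnit_det (A : Matrix m m ℂ) (B : Matrix m n ℂ)
    (C : Matrix n m ℂ) (D : Matrix n n ℂ) (hD : IsUnit D.det)
    (hM : IsUnit (Matrix.fromBlocks A B C D).det) :
    (Matrix.fromBlocks A B C D)⁻¹ =
      Matrix.fromBlocks (A - B * D⁻¹ * C)⁻¹ (-((A - B * D⁻¹ * C)⁻¹ * B * D⁻¹))
        (-(D⁻¹ * C * (A - B * D⁻¹ * C)⁻¹))
        (D⁻¹ + D⁻¹ * C * (A - B * D⁻¹ * C)⁻¹ * B * D⁻¹) := by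
  let := Matrix.invertibleOfIsUnitDet _ hD
  let := Matrix.invertibleOfIsUnitDet _ hM
  let := Matrix.invertibleOfFromBlocks₂₂Invertible A B C D
  have h := Matrix.invOf_fromBlocks₂₂_eq A B C D
  simpa only [Matrix.invOf_eq_nonsing_inv] using h

theorem trace_fromBlocks_eq_add {m n : Type*} [Fintype m] [Fintype n] (A : Matrix m m ℂ)
    (B : Matrix m n ℂ) (C : Matrix n m ℂ) (D : Matrix n n ℂ) :
    (Matrix.fromBlocks A B C D).trace = A.trace + D.trace := by
  simp [Matrix.trace, Fintype.sum_sum_type]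

end SchurComplement

section Toymodel

variable {d : ℕ}

theorem dist1_comm (x y : Fin d → ℤ) : dist1 x y = dist1 y x := by
  simp only [dist1, abs_sub_comm]

theorem dist1_self (x : Fin d → ℤ) : dist1 x x = 0 := by
  simp [dist1]

theorem card_filter_dist1_eq_one_le (Λ : Finset (Fin d → ℤ)) (j : Fin d → ℤ) :
    (Λ.filter (fun k => dist1 j k = 1)).card ≤ 3 ^ d := by
  have hsub : Λ.filter (fun k => dist1 j k = 1) ⊆
      Finset.Icc (fun i => j i - 1) (fun i => j i + 1) := by
    intro k hk
    rw [Finset.mem_filter] at hk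
    have hi : ∀ i, |j i - k i| ≤ 1 := fun i => by
      rw [← hk.2]
      exact Finset.single_le_sum (f := fun i => |j i - k i|) (fun _ _ => abs_nonneg _)
        (Finset.mem_univ i)
    rw [Finset.mem_Icc]
    constructor <;> intro i <;> have := abs_le.mp (hi i) <;> dsimp only <;> linarith
  refine (Finset.card_le_card hsub).trans ?_
  rw [Pi.card_Icc]
  have h3 : ∀ i, (Finset.Icc (j i - 1) (j i + 1)).card = 3 := fun i => by
    rw [Int.card_Icc]; omega
  simp [h3]

theorem sum_coe_ite_dist1_le (s : Finset (Fin d → ℤ)) (j : Fin d → ℤ) :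
    ∑ k : s, (if dist1 j (k : Fin d → ℤ) = 1 then (1 : ℝ) else 0) ≤ 3 ^ d := by
  rw [Finset.sum_coe_sort s (fun k => if dist1 j k = 1 then (1 : ℝ) else 0), Finset.sum_boole]
  exact_mod_cast card_filter_dist1_eq_one_le s j

/-- The self-adjoint matrix `E + Δ` restricted to the sites of `s`. -/
def energyLaplacian (Λ s : Finset (Fin d → ℤ)) (E : ℝ) : Matrix s s ℂ := fun j k =>
  (if j = k then (E : ℂ) else 0) + lapE Λ (j : Fin d → ℤ) (k : Fin d → ℤ)

theorem isHermitian_energyLaplacian (Λ s : Finset (Fin d → ℤ)) (E : ℝ) :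
    (energyLaplacian Λ s E).IsHermitian := by
  ext j k
  by_cases h : j = k
  · subst h
    simp only [Matrix.conjTranspose_apply, energyLaplacian, lapE, dist1_self]
    simp
  · have h' : (j : Fin d → ℤ) ≠ k := fun e => h (Subtype.ext e)
    simp only [Matrix.conjTranspose_apply, energyLaplacian, lapE, dist1_comm (k : Fin d → ℤ) j,
      if_neg h, if_neg h', if_neg (Ne.symm h), if_neg h'.symm]
    split_ifs <;> simp

theorem Bmat_eq_diagonal_sub (Λ : Finset (Fin d → ℤ)) (i₁ i₂ : Fin d → ℤ) (E lam : ℝ) :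
    Bmat Λ i₁ i₂ E lam = Matrix.diagonal (fun _ => (lam : ℂ)) -
      Complex.I • energyLaplacian Λ ((Λ.erase i₁).erase i₂) E := by
  ext j k
  simp [Bmat, energyLaplacian, Matrix.diagonal_apply]

theorem Cpp_eq_diagonal_sub (Λ : Finset (Fin d → ℤ)) (i₁ i₂ : Fin d → ℤ) (E lam δ : ℝ) :
    Cpp Λ i₁ i₂ E lam δ = Matrix.diagonal (fun j : Λ =>
        ((lam * (1 - δ ^ 2 * if (j : Fin d → ℤ) = i₁ ∨ (j : Fin d → ℤ) = i₂ then 1 else 0) : ℝ) :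
          ℂ)) - Complex.I • energyLaplacian Λ Λ E := by
  ext j k
  by_cases h : j = k
  · subst h
    by_cases h1 : (j : Fin d → ℤ) = i₁ ∨ (j : Fin d → ℤ) = i₂ <;>
      simp [Cpp, energyLaplacian, h1]
  · simp [Cpp, energyLaplacian, h]

theorem isCoerciveMatrix_Bmat (Λ : Finset (Fin d → ℤ)) (i₁ i₂ : Fin d → ℤ) (E lam : ℝ) :
    IsCoerciveMatrix (Bmat Λ i₁ i₂ E lam) lam := by
  rw [Bmat_eq_diagonal_sub]
  exact isCoerciveMatrix_diagonal_sub_I_smul (p := fun _ => lam) (fun _ => le_rfl)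
    (isHermitian_energyLaplacian _ _ _)

theorem isCoerciveMatrix_Cpp (Λ : Finset (Fin d → ℤ)) (i₁ i₂ : Fin d → ℤ) (E : ℝ) {lam δ : ℝ}
    (hlam : 0 < lam) (h0 : 0 < δ) (h1 : δ ≤ 1 / 2) :
    IsCoerciveMatrix (Cpp Λ i₁ i₂ E lam δ) (3 / 4 * lam) := by
  rw [Cpp_eq_diagonal_sub]
  refine isCoerciveMatrix_diagonal_sub_I_smul (fun j => ?_) (isHermitian_energyLaplacian _ _ _)
  rw [mul_comm]
  refine mul_le_mul_of_nonneg_left ?_ hlam.le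
  split_ifs <;> nlinarith

theorem norm_Cpp_apply_le (Λ : Finset (Fin d → ℤ)) (i₁ i₂ : Fin d → ℤ) (E : ℝ) {lam δ : ℝ}
    (hlam : 0 < lam) (h0 : 0 < δ) (h1 : δ ≤ 1 / 2) (j k : Λ) :
    ‖Cpp Λ i₁ i₂ E lam δ j k‖ ≤ (if k = j then lam + |E| + 3 ^ d else 0) +
      (if dist1 (j : Fin d → ℤ) (k : Fin d → ℤ) = 1 then 1 else 0) := by
  rw [Cpp_eq_diagonal_sub]
  by_cases h : j = k
  · subst h
    simp only [Matrix.sub_apply, Matrix.diagonal_apply_eq, Matrix.smul_apply, energyLaplacian,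
      lapE, dist1_self, if_true, smul_eq_mul]
    norm_num only [if_false, zero_sub, add_zero]
    refine (norm_sub_le _ _).trans ?_
    rw [add_assoc]
    refine add_le_add ?_ ?_
    · rw [Complex.norm_real, Real.norm_eq_abs, abs_le]
      split_ifs <;> constructor <;> nlinarith [mul_pos hlam h0]
    · rw [norm_mul, Complex.norm_I, one_mul]
      refine (norm_add_le _ _).trans (add_le_add ?_ ?_)
      · rw [Complex.norm_real, Real.norm_eq_abs]
      · rw [norm_neg, Complex.norm_natCast]
        exact_mod_cast card_filter_dist1_eq_one_le Λ j
  · have h' : (j : Fin d → ℤ) ≠ k := fun e => h (Subtype.ext e)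
    simp only [Matrix.sub_apply, Matrix.diagonal_apply_ne _ h, Matrix.smul_apply, energyLaplacian,
      lapE, if_neg h, if_neg h', if_neg (Ne.symm h)]
    split_ifs <;> simp

theorem norm_toLp_two_le_sum {n : Type*} [Fintype n] (v : n → ℂ) :
    ‖WithLp.toLp 2 v‖ ≤ ∑ k, ‖v k‖ := by
  rw [EuclideanSpace.norm_eq]
  refine Real.sqrt_le_iff.mpr ⟨Finset.sum_nonneg fun _ _ => norm_nonneg _, ?_⟩
  exact Finset.sum_sq_le_sq_sum_of_nonneg fun _ _ => norm_nonneg _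

theorem norm_Cpp_row_le (Λ : Finset (Fin d → ℤ)) (i₁ i₂ : Fin d → ℤ) (E : ℝ) {lam δ : ℝ}
    (hlam : 0 < lam) (h0 : 0 < δ) (h1 : δ ≤ 1 / 2) (j : Λ) :
    ‖WithLp.toLp 2 (star (Cpp Λ i₁ i₂ E lam δ j))‖ ≤ lam + |E| + 3 ^ d + 3 ^ d := by
  refine (norm_toLp_two_le_sum _).trans ?_
  simp only [Pi.star_apply, norm_star]
  refine (Finset.sum_le_sum fun k _ => norm_Cpp_apply_le Λ i₁ i₂ E hlam h0 h1 j k).trans ?_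
  rw [Finset.sum_add_distrib, Finset.sum_ite_eq' Finset.univ j, if_pos (Finset.mem_univ j)]
  exact add_le_add_right (sum_coe_ite_dist1_le Λ j) _

theorem norm_Dmat_row_sq_le (Λ : Finset (Fin d → ℤ)) (i₁ i₂ : Fin d → ℤ) (a : Fin 2) :
    ‖WithLp.toLp 2 (Dmat Λ i₁ i₂ a)‖ ^ 2 ≤ 3 ^ d := by
  rw [EuclideanSpace.norm_sq_eq]
  refine le_trans (Finset.sum_le_sum fun k _ => ?_) (sum_coe_ite_dist1_le _ (![i₁, i₂] a))
  simp only [Dmat]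
  split_ifs <;> simp

theorem star_Dmat_row (Λ : Finset (Fin d → ℤ)) (i₁ i₂ : Fin d → ℤ) (a : Fin 2) :
    star (Dmat Λ i₁ i₂ a) = Dmat Λ i₁ i₂ a := by
  ext k
  simp only [Pi.star_apply, Dmat]
  split_ifs <;> simp

theorem norm_Dmat_mul_inv_sq_mul_apply_le (Λ : Finset (Fin d → ℤ)) (i₁ i₂ : Fin d → ℤ) (E : ℝ)
    {lam : ℝ} (hlam : 0 < lam) (a b : Fin 2) :
    ‖(Dmat Λ i₁ i₂ * ((Bmat Λ i₁ i₂ E lam)⁻¹ * (Bmat Λ i₁ i₂ E lam)⁻¹) * (Dmat Λ i₁ i₂)ᵀ) a b‖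
      ≤ lam⁻¹ ^ 2 * 3 ^ d := by
  have hB := isCoerciveMatrix_Bmat Λ i₁ i₂ E lam
  have heq : (Dmat Λ i₁ i₂ * ((Bmat Λ i₁ i₂ E lam)⁻¹ * (Bmat Λ i₁ i₂ E lam)⁻¹) *
      (Dmat Λ i₁ i₂)ᵀ) a b = star (Dmat Λ i₁ i₂ a) ⬝ᵥ
        ((Bmat Λ i₁ i₂ E lam)⁻¹ *ᵥ ((Bmat Λ i₁ i₂ E lam)⁻¹ *ᵥ Dmat Λ i₁ i₂ b)) := by
    rw [star_Dmat_row, Matrix.mulVec_mulVec, Matrix.mul_assoc]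
    rfl
  rw [heq]
  refine (norm_star_dotProduct_le _ _).trans ?_
  have h1 := hB.norm_inv_mulVec_le hlam ((Bmat Λ i₁ i₂ E lam)⁻¹ *ᵥ Dmat Λ i₁ i₂ b)
  have h2 := hB.norm_inv_mulVec_le hlam (Dmat Λ i₁ i₂ b)
  have h3 := h1.trans (mul_le_mul_of_nonneg_left h2 (inv_pos.mpr hlam).le)
  have ha := norm_Dmat_row_sq_le Λ i₁ i₂ a
  have hb := norm_Dmat_row_sq_le Λ i₁ i₂ b
  refine (mul_le_mul_of_nonneg_left h3 (norm_nonneg _)).trans ?_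
  have hab : ‖WithLp.toLp 2 (Dmat Λ i₁ i₂ a)‖ * ‖WithLp.toLp 2 (Dmat Λ i₁ i₂ b)‖ ≤ 3 ^ d := by
    nlinarith [sq_nonneg (‖WithLp.toLp 2 (Dmat Λ i₁ i₂ a)‖ - ‖WithLp.toLp 2 (Dmat Λ i₁ i₂ b)‖)]
  calc _ = lam⁻¹ ^ 2 * (‖WithLp.toLp 2 (Dmat Λ i₁ i₂ a)‖ *
        ‖WithLp.toLp 2 (Dmat Λ i₁ i₂ b)‖) := by ring
    _ ≤ _ := mul_le_mul_of_nonneg_left hab (by positivity)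

/-- Splitting of the sites of `Λ` into `{i₁, i₂}` and the remaining ones. -/
def siteEquiv (Λ : Finset (Fin d → ℤ)) {i₁ i₂ : Fin d → ℤ} (hne : i₁ ≠ i₂) (h₁ : i₁ ∈ Λ)
    (h₂ : i₂ ∈ Λ) : Fin 2 ⊕ ((Λ.erase i₁).erase i₂) ≃ Λ :=
  Equiv.ofBijective
    (Sum.elim ![⟨i₁, h₁⟩, ⟨i₂, h₂⟩]
      (fun k => ⟨k, Finset.mem_of_mem_erase (Finset.mem_of_mem_erase k.2)⟩)) <| by
    constructor
    · rintro (a | k) (b | l) h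
      · fin_cases a <;> fin_cases b <;> simp_all
      · have hl := l.2
        simp only [Finset.mem_erase] at hl
        fin_cases a <;> simp [Subtype.ext_iff] at h <;> simp_all
      · have hk := k.2
        simp only [Finset.mem_erase] at hk
        fin_cases b <;> simp [Subtype.ext_iff] at h <;> simp_all
      · exact congrArg Sum.inr (Subtype.ext (congrArg Subtype.val h :))
    · rintro ⟨x, hx⟩
      by_cases hx1 : x = i₁
      · exact ⟨Sum.inl 0, by simp [hx1]⟩
      by_cases hx2 : x = i₂
      · exact ⟨Sum.inl 1, by simp [hx2]⟩
      · exact ⟨Sum.inr ⟨x, by simp [hx1, hx2, hx]⟩, by simp⟩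

theorem coe_siteEquiv_inl (Λ : Finset (Fin d → ℤ)) {i₁ i₂ : Fin d → ℤ} (hne : i₁ ≠ i₂)
    (h₁ : i₁ ∈ Λ) (h₂ : i₂ ∈ Λ) (a : Fin 2) :
    (siteEquiv Λ hne h₁ h₂ (Sum.inl a) : Fin d → ℤ) = ![i₁, i₂] a := by
  fin_cases a <;> rfl

theorem coe_siteEquiv_inr (Λ : Finset (Fin d → ℤ)) {i₁ i₂ : Fin d → ℤ} (hne : i₁ ≠ i₂)
    (h₁ : i₁ ∈ Λ) (h₂ : i₂ ∈ Λ) (k : ((Λ.erase i₁).erase i₂ : Finset (Fin d → ℤ))) :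
    (siteEquiv Λ hne h₁ h₂ (Sum.inr k) : Fin d → ℤ) = k :=
  rfl

theorem Cpp_submatrix_siteEquiv (Λ : Finset (Fin d → ℤ)) {i₁ i₂ : Fin d → ℤ} (hne : i₁ ≠ i₂)
    (h₁ : i₁ ∈ Λ) (h₂ : i₂ ∈ Λ) (E lam δ : ℝ) :
    (Cpp Λ i₁ i₂ E lam δ).submatrix (siteEquiv Λ hne h₁ h₂) (siteEquiv Λ hne h₁ h₂) =
      Matrix.fromBlocks
        (A0mat Λ i₁ i₂ E + ((lam : ℂ) * (1 - (δ : ℂ) ^ 2)) • (1 : Matrix (Fin 2) (Fin 2) ℂ))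
        (-Complex.I • Dmat Λ i₁ i₂) (-Complex.I • (Dmat Λ i₁ i₂)ᵀ) (Bmat Λ i₁ i₂ E lam) := by
  ext (a | k) (b | l)
  · fin_cases a <;> fin_cases b <;>
      simp [Cpp, A0mat, coe_siteEquiv_inl, hne, hne.symm] <;> ring
  · have hl := l.2
    simp only [Finset.mem_erase] at hl
    have ha : ![i₁, i₂] a ≠ l := by
      revert a
      exact Fin.forall_fin_two.mpr ⟨Ne.symm hl.2.1, Ne.symm hl.1⟩
    simp [Cpp, Dmat, lapE, coe_siteEquiv_inl, coe_siteEquiv_inr, ha]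
  · have hk := k.2
    simp only [Finset.mem_erase] at hk
    have hb : (k : Fin d → ℤ) ≠ ![i₁, i₂] b := by
      revert b
      exact Fin.forall_fin_two.mpr ⟨hk.2.1, hk.1⟩
    simp [Cpp, Dmat, lapE, coe_siteEquiv_inl, coe_siteEquiv_inr, hb,
      dist1_comm (k : Fin d → ℤ)]
  · have hk := k.2
    simp only [Finset.mem_erase] at hk
    simp [Cpp, Bmat, coe_siteEquiv_inr, hk.1, hk.2.1]

theorem Cpp_inv_submatrix_siteEquiv (Λ : Finset (Fin d → ℤ)) {i₁ i₂ : Fin d → ℤ} (hne : i₁ ≠ i₂)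
    (h₁ : i₁ ∈ Λ) (h₂ : i₂ ∈ Λ) (E : ℝ) {lam δ : ℝ} (hlam : 0 < lam)
    (hC : IsUnit (Cpp Λ i₁ i₂ E lam δ).det) :
    ((Cpp Λ i₁ i₂ E lam δ)⁻¹).submatrix (siteEquiv Λ hne h₁ h₂) (siteEquiv Λ hne h₁ h₂) =
      Matrix.fromBlocks (Spp Λ i₁ i₂ E lam δ)⁻¹
        (Complex.I • ((Spp Λ i₁ i₂ E lam δ)⁻¹ * Dmat Λ i₁ i₂ * (Bmat Λ i₁ i₂ E lam)⁻¹))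
        (Complex.I • ((Bmat Λ i₁ i₂ E lam)⁻¹ * (Dmat Λ i₁ i₂)ᵀ * (Spp Λ i₁ i₂ E lam δ)⁻¹))
        ((Bmat Λ i₁ i₂ E lam)⁻¹ - (Bmat Λ i₁ i₂ E lam)⁻¹ * (Dmat Λ i₁ i₂)ᵀ *
          (Spp Λ i₁ i₂ E lam δ)⁻¹ * Dmat Λ i₁ i₂ * (Bmat Λ i₁ i₂ E lam)⁻¹) := by
  have hB := (isCoerciveMatrix_Bmat Λ i₁ i₂ E lam).isUnit_det hlam
  have hblock := Cpp_submatrix_siteEquiv Λ hne h₁ h₂ E lam δ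
  rw [← Matrix.det_submatrix_equiv_self (siteEquiv Λ hne h₁ h₂), hblock] at hC
  have hS : A0mat Λ i₁ i₂ E + ((lam : ℂ) * (1 - (δ : ℂ) ^ 2)) • (1 : Matrix (Fin 2) (Fin 2) ℂ) -
      (-Complex.I • Dmat Λ i₁ i₂) * (Bmat Λ i₁ i₂ E lam)⁻¹ * (-Complex.I • (Dmat Λ i₁ i₂)ᵀ) =
      Spp Λ i₁ i₂ E lam δ := by
    simp [Spp, smul_smul]
  rw [← Matrix.inv_submatrix_equiv, hblock, inv_fromBlocks_eq_of_isUnit_det _ _ _ _ hB hC, hS]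
  congr 1 <;> simp [smul_smul, sub_eq_add_neg]

theorem trace_Cpp_inv_eq (Λ : Finset (Fin d → ℤ)) {i₁ i₂ : Fin d → ℤ} (hne : i₁ ≠ i₂)
    (h₁ : i₁ ∈ Λ) (h₂ : i₂ ∈ Λ) (E : ℝ) {lam δ : ℝ} (hlam : 0 < lam)
    (hC : IsUnit (Cpp Λ i₁ i₂ E lam δ).det) :
    Matrix.trace (Cpp Λ i₁ i₂ E lam δ)⁻¹ = Matrix.trace (Bmat Λ i₁ i₂ E lam)⁻¹ +
      Matrix.trace ((Spp Λ i₁ i₂ E lam δ)⁻¹ * ((1 : Matrix (Fin 2) (Fin 2) ℂ) -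
        Dmat Λ i₁ i₂ * ((Bmat Λ i₁ i₂ E lam)⁻¹ * (Bmat Λ i₁ i₂ E lam)⁻¹) *
          (Dmat Λ i₁ i₂)ᵀ)) := by
  have htr : Matrix.trace (Cpp Λ i₁ i₂ E lam δ)⁻¹ = Matrix.trace
      (((Cpp Λ i₁ i₂ E lam δ)⁻¹).submatrix (siteEquiv Λ hne h₁ h₂) (siteEquiv Λ hne h₁ h₂)) :=
    ((siteEquiv Λ hne h₁ h₂).sum_comp (fun j => (Cpp Λ i₁ i₂ E lam δ)⁻¹ j j)).symm
  rw [htr, Cpp_inv_submatrix_siteEquiv Λ hne h₁ h₂ E hlam hC, trace_fromBlocks_eq_add,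
    Matrix.trace_sub, Matrix.mul_sub, Matrix.mul_one, Matrix.trace_sub]
  have hcyc : Matrix.trace ((Bmat Λ i₁ i₂ E lam)⁻¹ * (Dmat Λ i₁ i₂)ᵀ *
      (Spp Λ i₁ i₂ E lam δ)⁻¹ * Dmat Λ i₁ i₂ * (Bmat Λ i₁ i₂ E lam)⁻¹) =
      Matrix.trace ((Spp Λ i₁ i₂ E lam δ)⁻¹ * (Dmat Λ i₁ i₂ *
        ((Bmat Λ i₁ i₂ E lam)⁻¹ * (Bmat Λ i₁ i₂ E lam)⁻¹) * (Dmat Λ i₁ i₂)ᵀ)) := by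
    have := Matrix.trace_mul_comm ((Bmat Λ i₁ i₂ E lam)⁻¹ * (Dmat Λ i₁ i₂)ᵀ)
      ((Spp Λ i₁ i₂ E lam δ)⁻¹ * Dmat Λ i₁ i₂ * (Bmat Λ i₁ i₂ E lam)⁻¹)
    simpa only [Matrix.mul_assoc] using this
  rw [hcyc]
  ring

theorem norm_Spp_inv_apply_le (Λ : Finset (Fin d → ℤ)) {i₁ i₂ : Fin d → ℤ} (hne : i₁ ≠ i₂)
    (h₁ : i₁ ∈ Λ) (h₂ : i₂ ∈ Λ) (E : ℝ) {lam δ c : ℝ} (hlam : 0 < lam) (hc : 0 < c)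
    (hC : IsCoerciveMatrix (Cpp Λ i₁ i₂ E lam δ) c) (a b : Fin 2) :
    ‖(Spp Λ i₁ i₂ E lam δ)⁻¹ a b‖ ≤ c⁻¹ := by
  have h := congrFun (congrFun (Cpp_inv_submatrix_siteEquiv Λ hne h₁ h₂ E hlam
    (hC.isUnit_det hc)) (Sum.inl a)) (Sum.inl b)
  rw [Matrix.fromBlocks_apply₁₁] at h
  rw [← h]
  exact hC.norm_inv_apply_le hc _ _

end Toymodel

theorem norm_trace_mul_le_of_norm_apply_le {n : Type*} [Fintype n] {A B : Matrix n n ℂ}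
    {a b : ℝ} (hA : ∀ i j, ‖A i j‖ ≤ a) (hB : ∀ i j, ‖B i j‖ ≤ b) :
    ‖Matrix.trace (A * B)‖ ≤ (Fintype.card n : ℝ) ^ 2 * (a * b) := by
  have h : ∀ i, ‖(A * B) i i‖ ≤ Fintype.card n * (a * b) := fun i => by
    rw [Matrix.mul_apply, ← nsmul_eq_mul]
    refine norm_sum_le_of_le _ (fun j _ => ?_) |>.trans (Finset.sum_const _).le
    rw [norm_mul]
    exact mul_le_mul (hA i j) (hB j i) (norm_nonneg _) ((norm_nonneg _).trans (hA i j))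
  refine (norm_sum_le_of_le _ fun i _ => h i).trans ?_
  rw [Finset.sum_const, nsmul_eq_mul, Finset.card_univ, sq, mul_assoc]

/-- Eq. (traceBC), uniform closeness of traces. One has the exact
identity `Tr C_{++}⁻¹ = Tr B⁻¹ + Tr(S_{++}⁻¹(1₂ - D B⁻² Dᵀ))`, and there is `K > 0`
depending only on `d`, `E` and `λ` (not on the cube `Λ`) with
`|Tr C_{++}⁻¹ - Tr B⁻¹| ≤ K` and `|Tr B⁻¹ / Tr C_{++}⁻¹ - 1| ≤ K/|Λ|`, i.e.
`Tr B⁻¹ / Tr C_{++}⁻¹ = 1 + O(|Λ|⁻¹)`. -/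
theorem trace_Cpp_close_to_trace_B (d : ℕ) (hd : 1 ≤ d) (E lam : ℝ) (hlam : 0 < lam) :
    ∃ K : ℝ, 0 < K ∧
      ∀ (i₁ i₂ : Fin d → ℤ), dist1 i₁ i₂ = 1 →
      ∀ (L : ℕ), i₁ ∈ cube d L → i₂ ∈ cube d L →
      ∀ (δ : ℝ), 0 < δ → δ ≤ 1 / 2 →
      Matrix.trace ((Cpp (cube d L) i₁ i₂ E lam δ)⁻¹) =
          Matrix.trace ((Bmat (cube d L) i₁ i₂ E lam)⁻¹) +
          Matrix.trace ((Spp (cube d L) i₁ i₂ E lam δ)⁻¹ *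
            ((1 : Matrix (Fin 2) (Fin 2) ℂ) -
              Dmat (cube d L) i₁ i₂ *
                ((Bmat (cube d L) i₁ i₂ E lam)⁻¹ * (Bmat (cube d L) i₁ i₂ E lam)⁻¹) *
                (Dmat (cube d L) i₁ i₂)ᵀ)) ∧
      norm (Matrix.trace ((Cpp (cube d L) i₁ i₂ E lam δ)⁻¹) -
          Matrix.trace ((Bmat (cube d L) i₁ i₂ E lam)⁻¹)) ≤ K ∧
      norm (Matrix.trace ((Bmat (cube d L) i₁ i₂ E lam)⁻¹) /
            Matrix.trace ((Cpp (cube d L) i₁ i₂ E lam δ)⁻¹) - 1) ≤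
        K / ((cube d L).card : ℝ) := by
  set c : ℝ := 3 / 4 * lam with hc_def
  have hc : 0 < c := by positivity
  set r : ℝ := lam + |E| + 3 ^ d + 3 ^ d
  have hr : 0 < r := by positivity
  set K₁ : ℝ := 2 ^ 2 * (c⁻¹ * (1 + lam⁻¹ ^ 2 * 3 ^ d))
  have hK₁ : 0 < K₁ := by positivity
  have hcr : 0 < c / r ^ 2 := by positivity
  refine ⟨K₁ + K₁ / (c / r ^ 2), by positivity, ?_⟩
  intro i₁ i₂ hdist L h₁ h₂ δ hδ0 hδ
  have hne : i₁ ≠ i₂ := by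
    rintro rfl
    simp [dist1_self] at hdist
  set Λ := cube d L
  have hC : IsCoerciveMatrix (Cpp Λ i₁ i₂ E lam δ) c :=
    isCoerciveMatrix_Cpp Λ i₁ i₂ E hlam hδ0 hδ
  have htrace := trace_Cpp_inv_eq Λ hne h₁ h₂ E hlam (hC.isUnit_det hc)
  have hbound : ‖Matrix.trace (Cpp Λ i₁ i₂ E lam δ)⁻¹ - Matrix.trace (Bmat Λ i₁ i₂ E lam)⁻¹‖
      ≤ K₁ := by
    rw [htrace, add_sub_cancel_left]
    have h := norm_trace_mul_le_of_norm_apply_le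
      (B := (1 : Matrix (Fin 2) (Fin 2) ℂ) - Dmat Λ i₁ i₂ *
        ((Bmat Λ i₁ i₂ E lam)⁻¹ * (Bmat Λ i₁ i₂ E lam)⁻¹) * (Dmat Λ i₁ i₂)ᵀ)
      (b := 1 + lam⁻¹ ^ 2 * 3 ^ d)
      (norm_Spp_inv_apply_le Λ hne h₁ h₂ E hlam hc hC) fun a b => by
        rw [Matrix.sub_apply]
        refine (norm_sub_le _ _).trans (add_le_add ?_
          (norm_Dmat_mul_inv_sq_mul_apply_le Λ i₁ i₂ E hlam a b))
        rw [Matrix.one_apply]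
        split_ifs <;> simp
    rwa [Fintype.card_fin, Nat.cast_ofNat] at h
  have hcard : (0 : ℝ) < Λ.card := by exact_mod_cast Finset.card_pos.mpr ⟨i₁, h₁⟩
  have hlower : (Λ.card : ℝ) * (c / r ^ 2) ≤ ‖Matrix.trace (Cpp Λ i₁ i₂ E lam δ)⁻¹‖ := by
    refine le_trans ?_ (Complex.re_le_norm _)
    rw [Matrix.trace, Complex.re_sum]
    have h := Finset.card_nsmul_le_sum Finset.univ
      (fun j => ((Cpp Λ i₁ i₂ E lam δ)⁻¹ j j).re) (c / r ^ 2)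
      fun j _ => hC.le_re_inv_apply_self hc hr j (norm_Cpp_row_le Λ i₁ i₂ E hlam hδ0 hδ j)
    rwa [Finset.card_univ, Fintype.card_coe, nsmul_eq_mul] at h
  have hpos : 0 < ‖Matrix.trace (Cpp Λ i₁ i₂ E lam δ)⁻¹‖ := lt_of_lt_of_le (by positivity) hlower
  refine ⟨htrace, hbound.trans (le_add_of_nonneg_right (by positivity)), ?_⟩
  rw [div_sub_one (norm_pos_iff.mp hpos), norm_div, norm_sub_rev]
  calc _ ≤ K₁ / (Λ.card * (c / r ^ 2)) := div_le_div₀ hK₁.le hbound (by positivity) hlower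
    _ = K₁ / (c / r ^ 2) / Λ.card := by rw [div_div, mul_comm]
    _ ≤ _ := div_le_div_of_nonneg_right (le_add_of_nonneg_left hK₁.le) hcard.le
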